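/- arXiv:2602.01159 — 2 statements merged into one kernel-verified Lean document; each statement's English description precedes it below -/
import Mathlib

section
/- Fix 0 < c < 1, 0 ≤ d < 1 and R > 0, and let K(c,d) = {λ·(cos θ cos φ, cos θ sin φ, sin θ) : θ ∈ [−π/2, π/2], φ ∈ [0, 2π), 0 ≤ λ ≤ R(1 + d·ρ_c(θ,φ))} ⊂ ℝ³. Then ∫_{K(c,d)} x₃ · (1 + |x|²)^{−5/2} dλ₃(x) = ∫₀^{2π} ∫_{−π/2}^{π/2} ( 2/3 − (3R²(1 + d·ρ_c(θ,φ))² + 2) / (3·(R²(1 + d·ρ_c(θ,φ))² + 1)^{3/2}) ) · cos θ · sin θ dθ dφ. (This is the computation establishing formula (eq:firstmoment) for the spherical first moment M₃(K(c,d)); it combines the change to spherical coordinates with the evaluation ∫₀^a r³(1+r²)^{−5/2} dr = 2/3 − (3a²+2)/(3(a²+1)^{3/2}).) -/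
open Real MeasureTheory

/-- The function `F_c` of the Várkonyi–Domokos construction. -/
noncomputable def Fc (c x : ℝ) : ℝ :=
  (c * x^2 + (1 - c) * (1 - x)^2 * (c * x / (c + x))) / (c * x + (1 - c) * (1 - x)^2)

noncomputable def fc (c θ : ℝ) : ℝ := π * Fc c (θ / π + 1/2) - π / 2

noncomputable def gc (c θ : ℝ) : ℝ := - fc c (-θ)

noncomputable def ac (c θ φ : ℝ) : ℝ :=
  cos φ ^ 2 * cos (fc c θ) ^ 2 /
    (cos φ ^ 2 * cos (fc c θ) ^ 2 + sin φ ^ 2 * cos (gc c θ) ^ 2)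

open Classical in
/-- The function `ρ_c(θ, φ)`, with values `±1` at the poles `θ = ±π/2`. -/
noncomputable def rhoc (c θ φ : ℝ) : ℝ :=
  if θ = π/2 then 1
  else if θ = -(π/2) then -1
  else ac c θ φ * sin (fc c θ) + (1 - ac c θ φ) * sin (gc c θ)

/-- The point of `S²` with spherical coordinates `(θ, φ)`. -/
noncomputable def sph (θ φ : ℝ) : EuclideanSpace ℝ (Fin 3) :=
  (EuclideanSpace.equiv (Fin 3) ℝ).symm ![cos θ * cos φ, cos θ * sin φ, sin θ]

/-- The star-shaped body `K(c,d)` with radial function `R(1 + d·ρ_c)`. -/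
noncomputable def Kbody (c d R : ℝ) : Set (EuclideanSpace ℝ (Fin 3)) :=
  {x | ∃ θ ∈ Set.Icc (-(π/2)) (π/2), ∃ φ ∈ Set.Ico 0 (2*π), ∃ l : ℝ,
    0 ≤ l ∧ l ≤ R * (1 + d * rhoc c θ φ) ∧ x = l • sph θ φ}

/-- The spherical-coordinate map `(φ, θ, r) ↦ r (cos θ cos φ, cos θ sin φ, sin θ)`. -/
noncomputable def sphericalMap (v : Fin 3 → ℝ) : Fin 3 → ℝ :=
  ![v 2 * (cos (v 1) * cos (v 0)), v 2 * (cos (v 1) * sin (v 0)), v 2 * sin (v 1)]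

/-- The Jacobian matrix of `sphericalMap`. -/
noncomputable def sphericalJacobian (v : Fin 3 → ℝ) : Matrix (Fin 3) (Fin 3) ℝ :=
  !![-(v 2 * (cos (v 1) * sin (v 0))), -(v 2 * (sin (v 1) * cos (v 0))), cos (v 1) * cos (v 0);
    v 2 * (cos (v 1) * cos (v 0)), -(v 2 * (sin (v 1) * sin (v 0))), cos (v 1) * sin (v 0);
    0, v 2 * cos (v 1), sin (v 1)]

lemma det_sphericalJacobian (v : Fin 3 → ℝ) :
    (sphericalJacobian v).det = v 2 ^ 2 * cos (v 1) := by
  simp only [sphericalJacobian, Matrix.det_fin_three, Matrix.of_apply, Matrix.cons_val]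
  linear_combination (v 2 ^ 2 * cos (v 1) * (sin (v 1) ^ 2 + cos (v 1) ^ 2)) *
    sin_sq_add_cos_sq (v 0) + v 2 ^ 2 * cos (v 1) * sin_sq_add_cos_sq (v 1)

lemma hasFDerivAt_sphericalMap (v : Fin 3 → ℝ) :
    HasFDerivAt sphericalMap
      (LinearMap.toContinuousLinearMap (Matrix.toLin' (sphericalJacobian v))) v := by
  have h (i : Fin 3) := hasFDerivAt_apply (𝕜 := ℝ) (F' := fun _ : Fin 3 => ℝ) i v
  rw [hasFDerivAt_pi']
  intro i
  fin_cases i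
  · change HasFDerivAt (fun v : Fin 3 → ℝ => v 2 * (cos (v 1) * cos (v 0))) _ v
    refine ((h 2).mul ((h 1).cos.mul (h 0).cos)).congr_fderiv ?_
    ext w
    simp [sphericalJacobian, Matrix.toLin'_apply, dotProduct, Fin.sum_univ_three]
    ring
  · change HasFDerivAt (fun v : Fin 3 → ℝ => v 2 * (cos (v 1) * sin (v 0))) _ v
    refine ((h 2).mul ((h 1).cos.mul (h 0).sin)).congr_fderiv ?_
    ext w
    simp [sphericalJacobian, Matrix.toLin'_apply, dotProduct, Fin.sum_univ_three]
    ring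
  · change HasFDerivAt (fun v : Fin 3 → ℝ => v 2 * sin (v 1)) _ v
    refine ((h 2).mul (h 1).sin).congr_fderiv ?_
    ext w
    simp [sphericalJacobian, Matrix.toLin'_apply, dotProduct, Fin.sum_univ_three]
    ring

lemma injOn_sphericalMap :
    Set.InjOn sphericalMap
      {v | v 0 ∈ Set.Ico 0 (2 * π) ∧ v 1 ∈ Set.Ioo (-(π / 2)) (π / 2) ∧ 0 < v 2} := by
  rintro v ⟨hv0, hv1, hv2⟩ w ⟨hw0, hw1, hw2⟩ h
  have e0 : v 2 * (cos (v 1) * cos (v 0)) = w 2 * (cos (w 1) * cos (w 0)) := congrFun h 0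
  have e1 : v 2 * (cos (v 1) * sin (v 0)) = w 2 * (cos (w 1) * sin (w 0)) := congrFun h 1
  have e2 : v 2 * sin (v 1) = w 2 * sin (w 1) := congrFun h 2
  have cv := cos_pos_of_mem_Ioo hv1
  have cw := cos_pos_of_mem_Ioo hw1
  have hρ : v 2 * cos (v 1) = w 2 * cos (w 1) := by
    refine (sq_eq_sq₀ (by positivity) (by positivity)).1 ?_
    linear_combination (v 2 * (cos (v 1) * cos (v 0)) + w 2 * (cos (w 1) * cos (w 0))) * e0 +
      (v 2 * (cos (v 1) * sin (v 0)) + w 2 * (cos (w 1) * sin (w 0))) * e1 -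
      (v 2 * cos (v 1)) ^ 2 * sin_sq_add_cos_sq (v 0) +
      (w 2 * cos (w 1)) ^ 2 * sin_sq_add_cos_sq (w 0)
  have h2 : v 2 = w 2 := by
    refine (sq_eq_sq₀ hv2.le hw2.le).1 ?_
    linear_combination (v 2 * cos (v 1) + w 2 * cos (w 1)) * hρ +
      (v 2 * sin (v 1) + w 2 * sin (w 1)) * e2 -
      v 2 ^ 2 * sin_sq_add_cos_sq (v 1) + w 2 ^ 2 * sin_sq_add_cos_sq (w 1)
  have h1 : v 1 = w 1 := by
    rw [h2] at e2
    exact injOn_sin (Set.Ioo_subset_Icc_self hv1) (Set.Ioo_subset_Icc_self hw1)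
      (mul_left_cancel₀ hw2.ne' e2)
  have h0 : v 0 = w 0 := by
    rw [h2, h1] at e0 e1
    have hc := mul_left_cancel₀ cw.ne' (mul_left_cancel₀ hw2.ne' e0)
    have hs := mul_left_cancel₀ cw.ne' (mul_left_cancel₀ hw2.ne' e1)
    have ha : (v 0 : Real.Angle) = w 0 := Real.Angle.cos_sin_inj hc hs
    obtain ⟨k, hk⟩ := Real.Angle.angle_eq_iff_two_pi_dvd_sub.1 ha
    have hk1 : (k : ℝ) < 1 := by nlinarith [hv0.2, hw0.1, pi_pos]
    have hk2 : (-1 : ℝ) < k := by nlinarith [hw0.2, hv0.1, pi_pos]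
    have hk0 : k = 0 := by
      have : k < 1 := by exact_mod_cast hk1
      have : -1 < k := by exact_mod_cast hk2
      omega
    simpa [hk0, sub_eq_zero] using hk
  ext i
  fin_cases i <;> assumption

lemma hasDerivAt_radial_primitive (r : ℝ) :
    HasDerivAt (fun r : ℝ => -((3 * r ^ 2 + 2) / (3 * (r ^ 2 + 1) ^ ((3 : ℝ) / 2))))
      (r ^ 3 * (1 + r ^ 2) ^ (-(5 : ℝ) / 2)) r := by
  have hp : 0 < r ^ 2 + 1 := by positivity
  have h1 : HasDerivAt (fun r : ℝ => r ^ 2 + 1) (2 * r) r := by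
    simpa using (hasDerivAt_pow 2 r).add_const 1
  have h2 : HasDerivAt (fun r : ℝ => 3 * r ^ 2 + 2) (6 * r) r := by
    refine (((hasDerivAt_pow 2 r).const_mul 3).add_const 2).congr_deriv ?_
    norm_num; ring
  have h3 := (h1.rpow_const (p := (3 : ℝ) / 2) (Or.inl hp.ne')).const_mul 3
  refine (h2.div h3 (by positivity)).neg.congr_deriv ?_
  have e5 : (1 + r ^ 2) ^ (-(5 : ℝ) / 2) = (√(r ^ 2 + 1) ^ 5)⁻¹ := by
    rw [add_comm, sqrt_eq_rpow, ← rpow_mul_natCast hp.le, ← rpow_neg hp.le]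
    norm_num
  have e3 : (r ^ 2 + 1) ^ ((3 : ℝ) / 2) = √(r ^ 2 + 1) ^ 3 := by
    rw [sqrt_eq_rpow, ← rpow_mul_natCast hp.le]
    norm_num
  have e1 : (r ^ 2 + 1) ^ ((3 : ℝ) / 2 - 1) = √(r ^ 2 + 1) := by
    rw [sqrt_eq_rpow]; norm_num
  rw [e5, e3, e1]
  have hs : √(r ^ 2 + 1) ^ 2 = r ^ 2 + 1 := sq_sqrt hp.le
  have hs0 : 0 < √(r ^ 2 + 1) := sqrt_pos.2 hp
  generalize √(r ^ 2 + 1) = s at *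
  field_simp
  linear_combination -6 * r * hs

lemma integral_radial (a : ℝ) :
    ∫ r in (0 : ℝ)..a, r ^ 3 * (1 + r ^ 2) ^ (-(5 : ℝ) / 2) =
      2 / 3 - (3 * a ^ 2 + 2) / (3 * (a ^ 2 + 1) ^ ((3 : ℝ) / 2)) := by
  rw [intervalIntegral.integral_eq_sub_of_hasDerivAt
    (fun r _ => hasDerivAt_radial_primitive r)]
  · norm_num; ring
  · refine Continuous.intervalIntegrable ?_ _ _
    exact (continuous_pow 3).mul (Continuous.rpow_const (by fun_prop)
      fun r => Or.inl (by positivity))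

lemma abs_rhoc_le_one (c θ φ : ℝ) : |rhoc c θ φ| ≤ 1 := by
  unfold rhoc
  split_ifs
  · simp
  · simp
  · have h0 : 0 ≤ ac c θ φ := by unfold ac; positivity
    have h1 : ac c θ φ ≤ 1 := by
      unfold ac
      exact div_le_one_of_le₀ (le_add_of_nonneg_right (by positivity)) (by positivity)
    rw [abs_le]
    constructor <;> nlinarith [sin_le_one (fc c θ), neg_one_le_sin (fc c θ),
      sin_le_one (gc c θ), neg_one_le_sin (gc c θ)]

lemma measurable_rhoc (c : ℝ) : Measurable fun p : ℝ × ℝ => rhoc c p.1 p.2 := by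
  have hf : Measurable (fc c) := by unfold fc Fc; fun_prop
  have hg : Measurable (gc c) := by unfold gc; fun_prop
  have ha : Measurable fun p : ℝ × ℝ => ac c p.1 p.2 := by unfold ac; fun_prop
  unfold rhoc
  refine Measurable.ite (measurable_fst (measurableSet_singleton _)) measurable_const
    (Measurable.ite (measurable_fst (measurableSet_singleton _)) measurable_const ?_)
  fun_prop

/-- The spherical coordinates `(φ, θ, r)` of the star body with radial function `u`. -/
def sphericalRegion (u : ℝ × ℝ → ℝ) : Set (Fin 3 → ℝ) :=
  {v | v 0 ∈ Set.Ico 0 (2 * π) ∧ v 1 ∈ Set.Ioo (-(π / 2)) (π / 2) ∧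
    v 2 ∈ Set.Ioc 0 (u (v 1, v 0))}

lemma measurableSet_sphericalRegion {u : ℝ × ℝ → ℝ} (hu : Measurable u) :
    MeasurableSet (sphericalRegion u) := by
  refine (measurableSet_Ico.preimage (measurable_pi_apply 0)).inter
    ((measurableSet_Ioo.preimage (measurable_pi_apply 1)).inter ?_)
  exact (measurableSet_lt measurable_const (measurable_pi_apply 2)).inter
    (measurableSet_le (measurable_pi_apply 2)
      (hu.comp ((measurable_pi_apply 1).prodMk (measurable_pi_apply 0))))

lemma volume_sphericalRegion_ne_top {u : ℝ × ℝ → ℝ} {B : ℝ} (hB : ∀ p, u p ≤ B) :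
    volume (sphericalRegion u) ≠ ⊤ := by
  refine ((measure_mono fun v hv => ?_).trans_lt
    (isCompact_Icc (a := ![0, -(π / 2), 0]) (b := ![2 * π, π / 2, B])).measure_lt_top).ne
  obtain ⟨h0, h1, h2⟩ := hv
  constructor <;> intro i <;> fin_cases i
  exacts [h0.1, h1.1.le, h2.1.le, h0.2.le, h1.2.le, h2.2.trans (hB _)]

/-- Iterated-integral form of an integral over a region in spherical coordinates. -/
lemma setIntegral_sphericalRegion {u : ℝ × ℝ → ℝ} (hu : Measurable u) (h0 : ∀ p, 0 ≤ u p)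
    {f : ℝ → ℝ → ℝ → ℝ}
    (hf : IntegrableOn (fun v : Fin 3 → ℝ => f (v 0) (v 1) (v 2)) (sphericalRegion u)) :
    ∫ v in sphericalRegion u, f (v 0) (v 1) (v 2) =
      ∫ φ in (0 : ℝ)..(2 * π), ∫ θ in (-(π / 2))..(π / 2),
        ∫ r in (0 : ℝ)..(u (θ, φ)), f φ θ r := by
  have hS := measurableSet_sphericalRegion hu
  let e : (Fin 3 → ℝ) ≃ᵐ ℝ × ℝ × ℝ := (MeasurableEquiv.piFinSuccAbove (fun _ => ℝ) 0).trans
    ((MeasurableEquiv.refl ℝ).prodCongr MeasurableEquiv.finTwoArrow)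
  have he : MeasurePreserving e volume volume :=
    ((MeasurePreserving.id volume).prod (volume_preserving_finTwoArrow ℝ)).comp
      (volume_preserving_piFinSuccAbove (fun _ : Fin 3 => ℝ) 0)
  let F : ℝ × ℝ × ℝ → ℝ := fun p => (Set.Ico 0 (2 * π)).indicator
    (fun φ => (Set.Ioo (-(π / 2)) (π / 2)).indicator
      (fun θ => (Set.Ioc 0 (u (θ, φ))).indicator (fun r => f φ θ r) p.2.2) p.2.1) p.1
  have hF : (sphericalRegion u).indicator (fun v => f (v 0) (v 1) (v 2)) = F ∘ e := by
    ext v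
    change _ = (Set.Ico 0 (2 * π)).indicator
      (fun φ => (Set.Ioo (-(π / 2)) (π / 2)).indicator
      (fun θ => (Set.Ioc 0 (u (θ, φ))).indicator (fun r => f φ θ r) (v 2)) (v 1)) (v 0)
    simp only [Set.indicator_apply, sphericalRegion, Set.mem_ofPred_eq, ite_and]
  have hFi : Integrable F := by
    rw [← he.integrable_comp_emb e.measurableEmbedding, ← hF]
    exact hf.integrable_indicator hS
  rw [← integral_indicator hS, hF]
  change ∫ v, F (e v) = _
  rw [he.integral_comp e.measurableEmbedding F, Measure.volume_eq_prod, integral_prod F hFi,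
    intervalIntegral.integral_of_le two_pi_pos.le, integral_Ioc_eq_integral_Ioo,
    ← integral_Ico_eq_integral_Ioo, ← integral_indicator measurableSet_Ico]
  refine integral_congr_ae ?_
  filter_upwards [hFi.prod_right_ae] with φ hφ
  rw [Measure.volume_eq_prod, integral_prod _ hφ]
  by_cases hφm : φ ∈ Set.Ico 0 (2 * π)
  · rw [Set.indicator_of_mem hφm, intervalIntegral.integral_of_le (by linarith [pi_pos]),
      integral_Ioc_eq_integral_Ioo, ← integral_indicator measurableSet_Ioo]
    congr 1 with θ
    by_cases hθ : θ ∈ Set.Ioo (-(π / 2)) (π / 2)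
    · simp only [F, Set.indicator_of_mem hφm, Set.indicator_of_mem hθ]
      rw [integral_indicator measurableSet_Ioc, intervalIntegral.integral_of_le (h0 _)]
    · simp only [F, Set.indicator_of_mem hφm, Set.indicator_of_notMem hθ, integral_zero]
  · simp only [F, Set.indicator_of_notMem hφm, integral_zero]

lemma norm_sq_toLp_sphericalMap (v : Fin 3 → ℝ) :
    ‖WithLp.toLp 2 (sphericalMap v)‖ ^ 2 = v 2 ^ 2 := by
  simp only [EuclideanSpace.norm_sq_eq, Fin.sum_univ_three, sphericalMap, Matrix.cons_val,
    norm_eq_abs, sq_abs]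
  linear_combination v 2 ^ 2 * cos (v 1) ^ 2 * sin_sq_add_cos_sq (v 0) +
    v 2 ^ 2 * sin_sq_add_cos_sq (v 1)

lemma smul_sph_eq_toLp_sphericalMap (l θ φ : ℝ) :
    l • sph θ φ = WithLp.toLp 2 (sphericalMap ![φ, θ, l]) := by
  ext i
  fin_cases i <;> simp [sph, sphericalMap]

lemma image_sphericalMap_ae_eq_Kbody (c d R : ℝ) :
    sphericalMap '' sphericalRegion (fun p => R * (1 + d * rhoc c p.1 p.2)) =ᵐ[volume]
      WithLp.toLp 2 ⁻¹' Kbody c d R := by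
  have hsub : sphericalMap '' sphericalRegion (fun p => R * (1 + d * rhoc c p.1 p.2)) ⊆
      WithLp.toLp 2 ⁻¹' Kbody c d R := by
    rintro _ ⟨v, ⟨h0, h1, h2⟩, rfl⟩
    refine ⟨v 1, Set.Ioo_subset_Icc_self h1, v 0, h0, v 2, h2.1.le, h2.2, ?_⟩
    rw [smul_sph_eq_toLp_sphericalMap]
    simp [sphericalMap]
  have hnull : volume {v : Fin 3 → ℝ | v 0 = 0} = 0 := by
    refine Measure.addHaar_submodule volume
      (LinearMap.ker (LinearMap.proj (R := ℝ) (φ := fun _ : Fin 3 => ℝ) 0)) fun h => ?_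
    have h1 : (fun _ => 1 : Fin 3 → ℝ) ∈
        LinearMap.ker (LinearMap.proj (R := ℝ) (φ := fun _ : Fin 3 => ℝ) 0) :=
      h ▸ Submodule.mem_top
    simp at h1
  refine hsub.eventuallyLE.antisymm (ae_le_set.2 (measure_mono_null ?_ hnull))
  rintro x ⟨⟨θ, hθ, φ, hφ, l, hl0, hl, hx⟩, hxn⟩
  rw [smul_sph_eq_toLp_sphericalMap] at hx
  obtain rfl : x = sphericalMap ![φ, θ, l] := WithLp.toLp_injective 2 hx
  by_contra hne
  change ¬ l * (cos θ * cos φ) = 0 at hne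
  refine hxn ⟨_, ⟨hφ, ⟨hθ.1.lt_of_ne ?_, hθ.2.lt_of_ne ?_⟩, hl0.lt_of_ne ?_, hl⟩, rfl⟩ <;>
    rintro h <;> apply hne
  · simp [← show -(π / 2) = θ from h]
  · simp [show θ = π / 2 from h]
  · simp [← show 0 = l from h]

lemma setIntegral_Kbody_eq_sphericalRegion (c d R : ℝ) (g : EuclideanSpace ℝ (Fin 3) → ℝ) :
    ∫ x in Kbody c d R, g x =
      ∫ v in sphericalRegion (fun p => R * (1 + d * rhoc c p.1 p.2)),
        v 2 ^ 2 * cos (v 1) * g (WithLp.toLp 2 (sphericalMap v)) := by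
  have hS : MeasurableSet (sphericalRegion (fun p => R * (1 + d * rhoc c p.1 p.2))) :=
    measurableSet_sphericalRegion (((measurable_rhoc c).const_mul d).const_add 1 |>.const_mul R)
  have hsub : sphericalRegion (fun p => R * (1 + d * rhoc c p.1 p.2)) ⊆
      {v | v 0 ∈ Set.Ico 0 (2 * π) ∧ v 1 ∈ Set.Ioo (-(π / 2)) (π / 2) ∧ 0 < v 2} :=
    fun v hv => ⟨hv.1, hv.2.1, hv.2.2.1⟩
  rw [← (PiLp.volume_preserving_toLp (Fin 3)).setIntegral_preimage_emb
      (MeasurableEquiv.toLp 2 (Fin 3 → ℝ)).measurableEmbedding,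
    ← setIntegral_congr_set (image_sphericalMap_ae_eq_Kbody c d R),
    integral_image_eq_integral_abs_det_fderiv_smul volume hS
      (fun v _ => (hasFDerivAt_sphericalMap v).hasFDerivWithinAt)
      (injOn_sphericalMap.mono hsub)]
  refine setIntegral_congr_fun hS fun v hv => ?_
  have hdet : (LinearMap.toContinuousLinearMap (Matrix.toLin' (sphericalJacobian v))).det =
      v 2 ^ 2 * cos (v 1) := by
    rw [LinearMap.det_toContinuousLinearMap, LinearMap.det_toLin', det_sphericalJacobian]
  have hcos := cos_pos_of_mem_Ioo hv.2.1
  simp only [hdet, smul_eq_mul]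
  rw [abs_of_nonneg (by positivity)]

/-- Formula (eq:firstmoment): the spherical first moment of `K(c,d)` with respect to the
great sphere `{x₃ = 0}` in the gnomonic model, computed in spherical coordinates. -/
theorem stmt_13 (c d R : ℝ) (hc0 : 0 < c) (hc1 : c < 1) (hd0 : 0 ≤ d) (hd1 : d < 1)
    (hR : 0 < R) :
    ∫ x in Kbody c d R, (x 2) * (1 + ‖x‖^2) ^ (-(5:ℝ)/2) ∂volume =
      ∫ φ in (0:ℝ)..(2*π), ∫ θ in (-(π/2))..(π/2),
        (2/3 - (3*R^2*(1 + d * rhoc c θ φ)^2 + 2) /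
          (3 * (R^2*(1 + d * rhoc c θ φ)^2 + 1) ^ ((3:ℝ)/2))) * cos θ * sin θ := by
  have hρ (p : ℝ × ℝ) := abs_le.1 (abs_rhoc_le_one c p.1 p.2)
  have hu : Measurable fun p : ℝ × ℝ => R * (1 + d * rhoc c p.1 p.2) :=
    ((measurable_rhoc c).const_mul d).const_add 1 |>.const_mul R
  have hu0 (p : ℝ × ℝ) : 0 ≤ R * (1 + d * rhoc c p.1 p.2) :=
    mul_nonneg hR.le (by nlinarith [hρ p])
  have hu2 (p : ℝ × ℝ) : R * (1 + d * rhoc c p.1 p.2) ≤ R * 2 :=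
    mul_le_mul_of_nonneg_left (by nlinarith [hρ p]) hR.le
  rw [setIntegral_Kbody_eq_sphericalRegion]
  have hint (v : Fin 3 → ℝ) :
      v 2 ^ 2 * cos (v 1) * ((WithLp.toLp 2 (sphericalMap v)) 2 *
        (1 + ‖WithLp.toLp 2 (sphericalMap v)‖ ^ 2) ^ (-(5 : ℝ) / 2)) =
      v 2 ^ 3 * (1 + v 2 ^ 2) ^ (-(5 : ℝ) / 2) * (cos (v 1) * sin (v 1)) := by
    rw [norm_sq_toLp_sphericalMap]
    simp only [sphericalMap, Matrix.cons_val]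
    ring
  simp_rw [hint]
  rw [setIntegral_sphericalRegion (f := fun _ θ r =>
    r ^ 3 * (1 + r ^ 2) ^ (-(5 : ℝ) / 2) * (cos θ * sin θ)) hu hu0]
  · simp only [intervalIntegral.integral_mul_const, integral_radial]
    simp only [mul_pow, mul_assoc]
  · refine Measure.integrableOn_of_bounded (volume_sphericalRegion_ne_top hu2)
      (by fun_prop) (M := (R * 2) ^ 3) ?_
    filter_upwards [ae_restrict_mem (measurableSet_sphericalRegion hu)] with v hv
    have hr : 0 < v 2 := hv.2.2.1
    have hpow : (1 + v 2 ^ 2) ^ (-(5 : ℝ) / 2) ≤ 1 :=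
      rpow_le_one_of_one_le_of_nonpos (by nlinarith) (by norm_num)
    have htrig : |cos (v 1) * sin (v 1)| ≤ 1 := by
      rw [abs_mul]
      exact mul_le_one₀ (abs_cos_le_one _) (abs_nonneg _) (abs_sin_le_one _)
    rw [norm_mul, norm_mul, norm_eq_abs, norm_eq_abs, norm_eq_abs, abs_of_pos (pow_pos hr 3),
      abs_of_pos (rpow_pos_of_pos (by positivity) _)]
    calc v 2 ^ 3 * (1 + v 2 ^ 2) ^ (-(5 : ℝ) / 2) * |cos (v 1) * sin (v 1)|
        ≤ (R * 2) ^ 3 * 1 * 1 := by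
          gcongr
          exact hv.2.2.2.trans (hu2 _)
      _ = (R * 2) ^ 3 := by ring
end

section
/- For every R > 0 there exist constants 0 < c₁ < c₂ < 1 and 0 < d₀ < 1 and a function F : (0, d₀) → [c₁, c₂] such that for every d ∈ (0, d₀), ∫₀^{2π} ∫_{−π/2}^{π/2} ( 2/3 − (3R²(1 + d·ρ_{F(d)}(θ,φ))² + 2) / (3·(R²(1 + d·ρ_{F(d)}(θ,φ))² + 1)^{3/2}) ) · cos θ · sin θ dθ dφ = 0. (This is Lemma 4.7: by the axial symmetry of K(c,d) about the x₃-axis, the vanishing of this first-moment integral M₃(K(F(d),d)) means exactly that the spherical centroid of the spherical convex body corresponding to K(F(d),d) under the gnomonic projection is the north pole v_N.) -/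
open Real MeasureTheory

open Set Topology Filter

/-- The quotient `F_c(θ/π + 1/2) / c`, extended to `c = 0`. -/
noncomputable def profileRatio (c θ : ℝ) : ℝ :=
  ((θ / π + 1/2)^2 + (1 - c) * (1 - (θ / π + 1/2))^2 * ((θ / π + 1/2) / (c + (θ / π + 1/2)))) /
    (c * (θ / π + 1/2) + (1 - c) * (1 - (θ / π + 1/2))^2)

/-- The quotient `cos (f_c(θ)) / (π c)`, extended to `c = 0`. -/
noncomputable def cosRatio (c θ : ℝ) : ℝ :=
  profileRatio c θ * sinc (π * (c * profileRatio c θ))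

/-- The extension of `a_c` to `c = 0`. -/
noncomputable def weight (c φ θ : ℝ) : ℝ :=
  cos φ ^ 2 * cosRatio c θ ^ 2 /
    (cos φ ^ 2 * cosRatio c θ ^ 2 + sin φ ^ 2 * cosRatio c (-θ) ^ 2)

/-- The extension of `ρ_c` to `c = 0`. -/
noncomputable def rhoExt (c φ θ : ℝ) : ℝ :=
  weight c φ θ * sin (fc c θ) + (1 - weight c φ θ) * sin (gc c θ)

/-- The open coordinate rectangle of the sphere. -/
def rect : Set (ℝ × ℝ) := Ioo 0 (2 * π) ×ˢ Ioo (-(π / 2)) (π / 2)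

lemma fc_eq (c θ : ℝ) : fc c θ = π * (c * profileRatio c θ) - π / 2 := by
  unfold fc Fc profileRatio
  ring

lemma cos_fc (c θ : ℝ) : cos (fc c θ) = π * c * cosRatio c θ := by
  rw [fc_eq, cos_sub_pi_div_two, cosRatio]
  by_cases h : π * (c * profileRatio c θ) = 0
  · rw [h]
    have : π * c * (profileRatio c θ * sinc 0) = π * (c * profileRatio c θ) * sinc 0 := by ring
    rw [this, h]; simp
  · rw [sinc_of_ne_zero h]
    have : π * c * (profileRatio c θ * (sin (π * (c * profileRatio c θ)) /
      (π * (c * profileRatio c θ)))) = (π * (c * profileRatio c θ)) *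
        (sin (π * (c * profileRatio c θ)) / (π * (c * profileRatio c θ))) := by ring
    rw [this, mul_div_cancel₀ _ h]

lemma cos_gc (c θ : ℝ) : cos (gc c θ) = π * c * cosRatio c (-θ) := by
  rw [gc, cos_neg, cos_fc]

lemma ac_eq_weight {c : ℝ} (hc : c ≠ 0) (θ φ : ℝ) : ac c θ φ = weight c φ θ := by
  have h : (π * c) ^ 2 ≠ 0 := pow_ne_zero _ (mul_ne_zero pi_ne_zero hc)
  rw [ac, weight, cos_fc, cos_gc]
  conv_rhs => rw [← mul_div_mul_left _ _ h]
  ring_nf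

lemma rhoc_eq_rhoExt {c θ : ℝ} (hc : c ≠ 0) (hθ : θ ∈ Ioo (-(π / 2)) (π / 2)) (φ : ℝ) :
    rhoc c θ φ = rhoExt c φ θ := by
  rw [rhoc, if_neg hθ.2.ne, if_neg hθ.1.ne', rhoExt, ac_eq_weight hc]

lemma weight_nonneg (c φ θ : ℝ) : 0 ≤ weight c φ θ := by
  unfold weight; positivity

lemma weight_le_one (c φ θ : ℝ) : weight c φ θ ≤ 1 := by
  unfold weight
  apply div_le_one_of_le₀
  · linarith [mul_nonneg (sq_nonneg (sin φ)) (sq_nonneg (cosRatio c (-θ)))]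
  · positivity

lemma abs_rhoExt_le_one (c φ θ : ℝ) : |rhoExt c φ θ| ≤ 1 := by
  have h0 := weight_nonneg c φ θ
  have h1 := weight_le_one c φ θ
  rw [rhoExt, abs_le]
  constructor <;> nlinarith [sin_le_one (fc c θ), sin_le_one (gc c θ),
    neg_one_le_sin (fc c θ), neg_one_le_sin (gc c θ)]

lemma div_pi_add_half_mem {θ : ℝ} (hθ : θ ∈ Ioo (-(π / 2)) (π / 2)) :
    θ / π + 1/2 ∈ Ioo (0 : ℝ) 1 := by
  have h1 : -(1/2) < θ / π := by
    rw [lt_div_iff₀ pi_pos]; linarith [hθ.1]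
  have h2 : θ / π < 1/2 := by
    rw [div_lt_iff₀ pi_pos]; linarith [hθ.2]
  exact ⟨by linarith, by linarith⟩

lemma profileRatio_denom_pos {c x : ℝ} (hc : c ∈ Icc (0 : ℝ) 1) (hx : x ∈ Ioo (0 : ℝ) 1) :
    0 < c * x + (1 - c) * (1 - x)^2 := by
  have hx1 : 0 < (1 - x)^2 := pow_pos (by linarith [hx.2]) 2
  rcases hc.1.eq_or_lt with rfl | h
  · simpa using hx1
  · have := mul_pos h hx.1
    have := mul_nonneg (sub_nonneg.2 hc.2) hx1.le
    linarith

lemma profileRatio_pos {c θ : ℝ} (hc : c ∈ Icc (0 : ℝ) 1) (hθ : θ ∈ Ioo (-(π / 2)) (π / 2)) :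
    0 < profileRatio c θ := by
  have hx := div_pi_add_half_mem hθ
  have hD := profileRatio_denom_pos hc hx
  unfold profileRatio
  generalize θ / π + 1/2 = x at *
  refine div_pos ?_ hD
  have h1 : 0 < x := hx.1
  have h2 : 0 ≤ 1 - c := sub_nonneg.2 hc.2
  have h3 : 0 ≤ c := hc.1
  positivity

lemma mul_profileRatio_lt_one {c θ : ℝ} (hc : c ∈ Icc (0 : ℝ) 1)
    (hθ : θ ∈ Ioo (-(π / 2)) (π / 2)) : c * profileRatio c θ < 1 := by
  have hx := div_pi_add_half_mem hθ
  have hD := profileRatio_denom_pos hc hx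
  unfold profileRatio
  generalize θ / π + 1/2 = x at *
  obtain ⟨hx0, hx1⟩ := hx
  obtain ⟨hc0, hc1⟩ := hc
  rw [← mul_div_assoc, div_lt_one hD]
  have hq : c * (x / (c + x)) ≤ x := by
    rw [← mul_div_assoc, div_le_iff₀ (by linarith)]
    nlinarith
  have hw : 0 ≤ (1 - c) * (1 - x)^2 := mul_nonneg (by linarith) (sq_nonneg _)
  have hle : c * (x^2 + (1 - c) * (1 - x)^2 * (x / (c + x))) ≤
      x * (c * x + (1 - c) * (1 - x)^2) := by
    nlinarith [mul_le_mul_of_nonneg_left hq hw]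
  nlinarith

lemma cosRatio_pos {c θ : ℝ} (hc : c ∈ Icc (0 : ℝ) 1) (hθ : θ ∈ Ioo (-(π / 2)) (π / 2)) :
    0 < cosRatio c θ := by
  refine mul_pos (profileRatio_pos hc hθ) ?_
  have h0 : 0 ≤ c * profileRatio c θ := mul_nonneg hc.1 (profileRatio_pos hc hθ).le
  have h1 := mul_profileRatio_lt_one hc hθ
  generalize c * profileRatio c θ = y at *
  rcases h0.eq_or_lt with rfl | h
  · simp
  · have hy : 0 < π * y := mul_pos pi_pos h
    rw [sinc_of_ne_zero hy.ne']
    exact div_pos (sin_pos_of_pos_of_lt_pi hy (by nlinarith [pi_pos])) hy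

lemma neg_mem_Ioo_pi {θ : ℝ} (hθ : θ ∈ Ioo (-(π / 2)) (π / 2)) :
    -θ ∈ Ioo (-(π / 2)) (π / 2) :=
  ⟨by linarith [hθ.2], by linarith [hθ.1]⟩

lemma weight_denom_pos {c θ : ℝ} (hc : c ∈ Icc (0 : ℝ) 1) (hθ : θ ∈ Ioo (-(π / 2)) (π / 2))
    (φ : ℝ) : 0 < cos φ ^ 2 * cosRatio c θ ^ 2 + sin φ ^ 2 * cosRatio c (-θ) ^ 2 := by
  have h1 := pow_pos (cosRatio_pos hc hθ) 2
  have h2 := pow_pos (cosRatio_pos hc (neg_mem_Ioo_pi hθ)) 2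
  by_cases h : sin φ = 0
  · have : cos φ ^ 2 = 1 := by nlinarith [sin_sq_add_cos_sq φ]
    rw [h, this]; linarith
  · have := mul_pos (pow_pos (abs_pos.2 h) 2) h2
    rw [sq_abs] at this
    have := mul_nonneg (sq_nonneg (cos φ)) h1.le
    linarith

lemma continuousOn_profileRatio :
    ContinuousOn (fun q : ℝ × ℝ => profileRatio q.1 q.2)
      (Icc 0 1 ×ˢ Ioo (-(π / 2)) (π / 2)) := by
  unfold profileRatio
  refine ContinuousOn.div ?_ (by fun_prop) fun q hq =>
    (profileRatio_denom_pos hq.1 (div_pi_add_half_mem hq.2)).ne'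
  refine ContinuousOn.add (by fun_prop) (ContinuousOn.mul (by fun_prop) ?_)
  refine ContinuousOn.div (by fun_prop) (by fun_prop) fun q hq => ?_
  have h1 := (div_pi_add_half_mem hq.2).1
  have h2 := hq.1.1
  exact (by linarith : 0 < q.1 + (q.2 / π + 1/2)).ne'

lemma continuousOn_cosRatio :
    ContinuousOn (fun q : ℝ × ℝ => cosRatio q.1 q.2)
      (Icc 0 1 ×ˢ Ioo (-(π / 2)) (π / 2)) := by
  unfold cosRatio
  have h := continuousOn_profileRatio
  exact h.mul (continuous_sinc.comp_continuousOn
    (continuousOn_const.mul (continuousOn_fst.mul h)))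

lemma continuousOn_fc :
    ContinuousOn (fun q : ℝ × ℝ => fc q.1 q.2)
      (Icc 0 1 ×ˢ Ioo (-(π / 2)) (π / 2)) := by
  simp only [fc_eq]
  exact (continuousOn_const.mul (continuousOn_fst.mul continuousOn_profileRatio)).sub
    continuousOn_const

lemma continuousOn_rhoExt :
    ContinuousOn (fun q : (ℝ × ℝ) × (ℝ × ℝ) => rhoExt q.1.1 q.2.1 q.2.2)
      ((Icc 0 1 ×ˢ Icc 0 1) ×ˢ rect) := by
  have m1 : MapsTo (fun q : (ℝ × ℝ) × (ℝ × ℝ) => (q.1.1, q.2.2))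
      ((Icc 0 1 ×ˢ Icc 0 1) ×ˢ rect) (Icc 0 1 ×ˢ Ioo (-(π / 2)) (π / 2)) :=
    fun q hq => ⟨hq.1.1, hq.2.2⟩
  have m2 : MapsTo (fun q : (ℝ × ℝ) × (ℝ × ℝ) => (q.1.1, -q.2.2))
      ((Icc 0 1 ×ˢ Icc 0 1) ×ˢ rect) (Icc 0 1 ×ˢ Ioo (-(π / 2)) (π / 2)) :=
    fun q hq => ⟨hq.1.1, neg_mem_Ioo_pi hq.2.2⟩
  have c1 := continuousOn_cosRatio.comp (by fun_prop) m1
  have c2 := continuousOn_cosRatio.comp (by fun_prop) m2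
  have f1 := continuousOn_fc.comp (by fun_prop) m1
  have f2 := continuousOn_fc.comp (by fun_prop) m2
  have w : ContinuousOn (fun q : (ℝ × ℝ) × (ℝ × ℝ) => weight q.1.1 q.2.1 q.2.2)
      ((Icc 0 1 ×ˢ Icc 0 1) ×ˢ rect) := by
    unfold weight
    have hcos : ContinuousOn (fun q : (ℝ × ℝ) × (ℝ × ℝ) => cos q.2.1 ^ 2)
      ((Icc 0 1 ×ˢ Icc 0 1) ×ˢ rect) := by fun_prop
    have hsin : ContinuousOn (fun q : (ℝ × ℝ) × (ℝ × ℝ) => sin q.2.1 ^ 2)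
      ((Icc 0 1 ×ˢ Icc 0 1) ×ˢ rect) := by fun_prop
    exact (hcos.mul (c1.pow 2)).div ((hcos.mul (c1.pow 2)).add (hsin.mul (c2.pow 2)))
      fun q hq => (weight_denom_pos hq.1.1 hq.2.2 _).ne'
  unfold rhoExt gc
  exact (w.mul (continuous_sin.comp_continuousOn f1)).add
    ((continuousOn_const.sub w).mul (continuous_sin.comp_continuousOn f2.neg))

/-- The radial density of the spherical first moment. -/
noncomputable def momentDensity (R r : ℝ) : ℝ :=
  2/3 - (3*R^2*r^2 + 2) / (3 * (R^2*r^2 + 1) ^ ((3:ℝ)/2))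

lemma hasDerivAt_momentDensity (R r : ℝ) :
    HasDerivAt (momentDensity R) (R^4 * r^3 * (R^2*r^2 + 1) ^ (-(5:ℝ)/2)) r := by
  have hu : 0 < R^2*r^2 + 1 := by positivity
  have hsq : HasDerivAt (fun r : ℝ => r^2) (2 * r) r := by simpa using hasDerivAt_pow 2 r
  have h1 : HasDerivAt (fun r : ℝ => R^2*r^2 + 1) (R^2 * (2 * r)) r :=
    (hsq.const_mul (R^2)).add_const 1
  have h2 : HasDerivAt (fun r : ℝ => 3*R^2*r^2 + 2) (3*R^2 * (2 * r)) r :=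
    (hsq.const_mul (3*R^2)).add_const 2
  have h3 := (h1.rpow_const (p := (3:ℝ)/2) (Or.inl hu.ne')).const_mul 3
  have h4 := (h2.div h3 (by positivity)).const_sub (2/3)
  refine h4.congr_deriv ?_
  have e1 : (R^2*r^2 + 1) ^ ((3:ℝ)/2) = (R^2*r^2 + 1) * √(R^2*r^2 + 1) := by
    rw [sqrt_eq_rpow, ← rpow_one_add' hu.le (by norm_num)]
    norm_num
  have e2 : (R^2*r^2 + 1) ^ ((3:ℝ)/2 - 1) = √(R^2*r^2 + 1) := by
    rw [sqrt_eq_rpow]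
    norm_num
  have e3 : (R^2*r^2 + 1) ^ (-(5:ℝ)/2) = √(R^2*r^2 + 1) / (R^2*r^2 + 1) ^ 3 := by
    rw [sqrt_eq_rpow, ← rpow_natCast (R^2*r^2 + 1) 3, ← rpow_sub hu]
    norm_num
  rw [e1, e2, e3]
  have hs : 0 < √(R^2*r^2 + 1) := sqrt_pos.2 hu
  have hs2 : √(R^2*r^2 + 1) ^ 2 = R^2*r^2 + 1 := sq_sqrt hu.le
  rw [← neg_div, div_eq_iff (by positivity)]
  generalize √(R^2*r^2 + 1) = s at *
  field_simp
  rw [hs2]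
  ring

lemma continuous_dslope_momentDensity (R : ℝ) : Continuous (dslope (momentDensity R) 1) := by
  rw [← continuousOn_univ, continuousOn_dslope univ_mem]
  exact ⟨fun r _ => (hasDerivAt_momentDensity R r).continuousAt.continuousWithinAt,
    (hasDerivAt_momentDensity R 1).differentiableAt⟩

lemma momentDensity_one_add (R t : ℝ) :
    momentDensity R (1 + t) = momentDensity R 1 + t * dslope (momentDensity R) 1 (1 + t) := by
  have := sub_smul_dslope (momentDensity R) 1 (1 + t)
  rw [add_sub_cancel_left, smul_eq_mul] at this
  rw [this]; ring

/-- The integrand of the first moment after division by `d`, extended to `d = 0`. -/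
noncomputable def reducedIntegrand (R : ℝ) (p z : ℝ × ℝ) : ℝ :=
  rhoExt p.1 z.1 z.2 * dslope (momentDensity R) 1 (1 + p.2 * rhoExt p.1 z.1 z.2) *
    (cos z.2 * sin z.2)

lemma continuousOn_reducedIntegrand (R : ℝ) :
    ContinuousOn (fun q : (ℝ × ℝ) × (ℝ × ℝ) => reducedIntegrand R q.1 q.2)
      ((Icc 0 1 ×ˢ Icc 0 1) ×ˢ rect) := by
  have h := continuousOn_rhoExt
  unfold reducedIntegrand
  refine (h.mul ((continuous_dslope_momentDensity R).comp_continuousOn ?_)).mul (by fun_prop)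
  exact continuousOn_const.add (ContinuousOn.mul (by fun_prop) h)

lemma measurableSet_rect : MeasurableSet rect := measurableSet_Ioo.prod measurableSet_Ioo

lemma volume_rect_ne_top : volume rect ≠ ⊤ :=
  ((Metric.isBounded_Ioo _ _).prod (Metric.isBounded_Ioo _ _)).measure_lt_top.ne

lemma aestronglyMeasurable_reducedIntegrand (R : ℝ) {p : ℝ × ℝ}
    (hp : p ∈ Icc (0 : ℝ) 1 ×ˢ Icc (0 : ℝ) 1) :
    AEStronglyMeasurable (reducedIntegrand R p) (volume.restrict rect) :=
  ((continuousOn_reducedIntegrand R).comp (f := fun z : ℝ × ℝ => (p, z)) (s := rect)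
    (by fun_prop) fun _ hz => ⟨hp, hz⟩).aestronglyMeasurable measurableSet_rect

lemma exists_bound_reducedIntegrand (R : ℝ) :
    ∃ C : ℝ, ∀ p ∈ Icc (0 : ℝ) 1 ×ˢ Icc (0 : ℝ) 1, ∀ z, ‖reducedIntegrand R p z‖ ≤ C := by
  obtain ⟨C, hC⟩ := (isCompact_Icc (a := (0 : ℝ)) (b := 2)).exists_bound_of_continuousOn
    (continuous_dslope_momentDensity R).continuousOn
  refine ⟨C, fun p hp z => ?_⟩
  have hr := abs_rhoExt_le_one p.1 z.1 z.2
  have hd : |p.2 * rhoExt p.1 z.1 z.2| ≤ 1 := by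
    rw [abs_mul, abs_of_nonneg hp.2.1]
    exact mul_le_one₀ hp.2.2 (abs_nonneg _) hr
  have hk := hC (1 + p.2 * rhoExt p.1 z.1 z.2)
    ⟨by linarith [(abs_le.1 hd).1], by linarith [(abs_le.1 hd).2]⟩
  have hC0 : 0 ≤ C := (norm_nonneg _).trans hk
  have hcs : |cos z.2 * sin z.2| ≤ 1 := by
    rw [abs_mul]
    exact mul_le_one₀ (abs_cos_le_one _) (abs_nonneg _) (abs_sin_le_one _)
  rw [reducedIntegrand, norm_mul, norm_mul]
  calc _ ≤ 1 * C * 1 := by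
        gcongr
        · exact hr
        · exact hcs
    _ = C := by ring

lemma integrableOn_reducedIntegrand (R : ℝ) {p : ℝ × ℝ}
    (hp : p ∈ Icc (0 : ℝ) 1 ×ˢ Icc (0 : ℝ) 1) :
    IntegrableOn (reducedIntegrand R p) rect := by
  obtain ⟨C, hC⟩ := exists_bound_reducedIntegrand R
  exact (integrableOn_const volume_rect_ne_top (C := C)).mono'
    (aestronglyMeasurable_reducedIntegrand R hp) (ae_of_all _ (hC p hp))

lemma continuousOn_integral_reducedIntegrand (R : ℝ) :
    ContinuousOn (fun p => ∫ z in rect, reducedIntegrand R p z)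
      (Icc (0 : ℝ) 1 ×ˢ Icc (0 : ℝ) 1) := by
  obtain ⟨C, hC⟩ := exists_bound_reducedIntegrand R
  refine continuousOn_of_dominated (bound := fun _ => C)
    (fun p hp => aestronglyMeasurable_reducedIntegrand R hp)
    (fun p hp => ae_of_all _ (hC p hp)) (integrableOn_const volume_rect_ne_top) ?_
  filter_upwards [ae_restrict_mem measurableSet_rect] with z hz
  exact (continuousOn_reducedIntegrand R).comp (f := fun p : ℝ × ℝ => (p, z))
    (s := Icc (0 : ℝ) 1 ×ˢ Icc (0 : ℝ) 1) (by fun_prop) fun p hp => ⟨hp, hz⟩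

lemma Continuous.integrableOn_rect {g : ℝ × ℝ → ℝ} (hg : Continuous g) :
    IntegrableOn g rect := by
  refine (hg.continuousOn.integrableOn_compact
    ((isCompact_Icc (a := (0:ℝ)) (b := 2 * π)).prod
      (isCompact_Icc (a := -(π / 2)) (b := π / 2)))).mono_set ?_
  exact prod_mono Ioo_subset_Icc_self Ioo_subset_Icc_self

lemma setIntegral_rect_mul_cos_sin (g : ℝ → ℝ) :
    ∫ z in rect, g z.1 * (cos z.2 * sin z.2) = 0 := by
  have h : ∫ θ in Ioo (-(π / 2)) (π / 2), cos θ * sin θ = 0 := by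
    rw [← integral_Ioc_eq_integral_Ioo, ← intervalIntegral.integral_of_le (by linarith [pi_pos])]
    simp_rw [mul_comm (cos _)]
    rw [integral_sin_mul_cos₁]
    simp
  rw [rect, Measure.volume_eq_prod, setIntegral_prod_mul g (fun θ => cos θ * sin θ), h, mul_zero]

lemma setIntegral_rect_pos {g : ℝ × ℝ → ℝ} (hg : IntegrableOn g rect)
    (h0 : ∀ z ∈ rect, 0 ≤ g z)
    (h1 : ∀ z ∈ Ioo (0 : ℝ) (π / 2) ×ˢ Ioo (0 : ℝ) (π / 2), 0 < g z) :
    0 < ∫ z in rect, g z := by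
  rw [setIntegral_pos_iff_support_of_nonneg_ae
    ((ae_restrict_mem measurableSet_rect).mono h0) hg]
  have hpi := pi_pos
  have hsub : Ioo (0 : ℝ) (π / 2) ×ˢ Ioo (0 : ℝ) (π / 2) ⊆ Function.support g ∩ rect :=
    fun z hz => ⟨(h1 z hz).ne',
      ⟨hz.1.1, by linarith [hz.1.2]⟩, ⟨by linarith [hz.2.1], hz.2.2⟩⟩
  refine lt_of_lt_of_le ?_ (measure_mono hsub)
  refine (isOpen_Ioo.prod isOpen_Ioo).measure_pos _ ⟨(π / 4, π / 4), ?_⟩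
  simp only [mem_prod, mem_Ioo]
  refine ⟨⟨?_, ?_⟩, ?_, ?_⟩ <;> linarith

lemma dslope_momentDensity_one_pos {R : ℝ} (hR : 0 < R) :
    0 < dslope (momentDensity R) 1 1 := by
  rw [dslope_same, (hasDerivAt_momentDensity R 1).deriv]
  positivity

lemma integral_reducedIntegrand_one_pos {R : ℝ} (hR : 0 < R) :
    0 < ∫ z in rect, reducedIntegrand R (1, 0) z := by
  have hk := dslope_momentDensity_one_pos hR
  have heq : ∀ z ∈ rect, reducedIntegrand R (1, 0) z =
      dslope (momentDensity R) 1 1 * (sin z.2 ^ 2 * cos z.2) := by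
    intro z hz
    have hf : ∀ θ ∈ Ioo (-(π / 2)) (π / 2), fc 1 θ = θ := by
      intro θ hθ
      have := (div_pi_add_half_mem hθ).1.ne'
      have hpi := pi_ne_zero
      have hF : Fc 1 (θ / π + 1/2) = θ / π + 1/2 := by
        unfold Fc
        generalize θ / π + 1/2 = x at *
        simp only [sub_self, zero_mul, one_mul, add_zero]
        field_simp
      rw [fc, hF]
      field_simp
      ring
    have hr : rhoExt 1 z.1 z.2 = sin z.2 := by
      rw [rhoExt, gc, hf _ hz.2, hf _ (neg_mem_Ioo_pi hz.2), neg_neg]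
      ring
    simp only [reducedIntegrand, hr, zero_mul, add_zero]
    ring
  rw [setIntegral_congr_fun measurableSet_rect heq]
  refine setIntegral_rect_pos (Continuous.integrableOn_rect (by fun_prop)) ?_ ?_
  · intro z hz
    have := (cos_pos_of_mem_Ioo hz.2).le
    positivity
  · intro z hz
    have h1 := cos_pos_of_mem_Ioo (x := z.2) ⟨by linarith [hz.2.1, pi_pos], hz.2.2⟩
    have h2 := sin_pos_of_pos_of_lt_pi hz.2.1 (by linarith [hz.2.2, pi_pos])
    positivity

lemma cosRatio_zero {θ : ℝ} (hθ : θ ∈ Ioo (-(π / 2)) (π / 2)) :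
    cosRatio 0 θ = ((θ / π + 1/2)^2 + (1 - (θ / π + 1/2))^2) / (1 - (θ / π + 1/2))^2 := by
  have := (div_pi_add_half_mem hθ).1.ne'
  rw [cosRatio, zero_mul, mul_zero, sinc_zero, mul_one, profileRatio, zero_add, div_self this]
  simp

lemma cosRatio_zero_neg_lt {θ : ℝ} (h0 : 0 < θ) (h1 : θ < π / 2) :
    cosRatio 0 (-θ) < cosRatio 0 θ := by
  have hm : θ ∈ Ioo (-(π / 2)) (π / 2) := ⟨by linarith [pi_pos], h1⟩
  have hy : 0 < θ / π := div_pos h0 pi_pos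
  have hx := div_pi_add_half_mem hm
  rw [cosRatio_zero hm, cosRatio_zero (neg_mem_Ioo_pi hm), neg_div]
  generalize θ / π = y at *
  have e1 : (-y + 1/2)^2 + (1 - (-y + 1/2))^2 = (y + 1/2)^2 + (1 - (y + 1/2))^2 := by ring
  rw [e1]
  have h2 := hx.2
  refine div_lt_div_of_pos_left (by positivity) (pow_pos (by linarith) 2) ?_
  nlinarith

lemma cos_sq_lt_div {u v p q : ℝ} (hu : 0 < u) (hv : 0 < v) (huv : u + v = 1) (hp : 0 < p)
    (hq : 0 < q) (hqp : q < p) : u < u * p ^ 2 / (u * p ^ 2 + v * q ^ 2) := by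
  rw [lt_div_iff₀ (by positivity)]
  have : q ^ 2 < p ^ 2 := by nlinarith
  have : u * p ^ 2 + v * q ^ 2 < p ^ 2 := by nlinarith
  nlinarith

lemma weight_zero_sub_mul_sin {φ θ : ℝ} (hθ : θ ∈ Ioo (-(π / 2)) (π / 2)) :
    0 ≤ (weight 0 φ θ - cos φ ^ 2) * sin θ := by
  have hc : (0 : ℝ) ∈ Icc (0 : ℝ) 1 := by simp
  have hD := weight_denom_pos hc hθ φ
  have hp := cosRatio_pos hc hθ
  have hq := cosRatio_pos hc (neg_mem_Ioo_pi hθ)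
  have hcs : cos φ ^ 2 * sin φ ^ 2 ≥ 0 := by positivity
  have key : weight 0 φ θ - cos φ ^ 2 = cos φ ^ 2 * sin φ ^ 2 *
      (cosRatio 0 θ ^ 2 - cosRatio 0 (-θ) ^ 2) /
      (cos φ ^ 2 * cosRatio 0 θ ^ 2 + sin φ ^ 2 * cosRatio 0 (-θ) ^ 2) := by
    rw [weight, eq_div_iff hD.ne', sub_mul, div_mul_cancel₀ _ hD.ne', sin_sq]
    ring
  rw [key]
  rcases lt_trichotomy θ 0 with h | rfl | h
  · have hlt := cosRatio_zero_neg_lt (neg_pos.2 h) (neg_mem_Ioo_pi hθ).2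
    rw [neg_neg] at hlt
    refine mul_nonneg_of_nonpos_of_nonpos (div_nonpos_of_nonpos_of_nonneg
      (mul_nonpos_of_nonneg_of_nonpos hcs (by nlinarith)) hD.le) ?_
    exact sin_nonpos_of_nonpos_of_neg_pi_le h.le (by linarith [hθ.1, pi_pos])
  · simp
  · have hlt := cosRatio_zero_neg_lt h hθ.2
    refine mul_nonneg (div_nonneg (mul_nonneg hcs (by nlinarith)) hD.le) ?_
    exact sin_nonneg_of_nonneg_of_le_pi h.le (by linarith [hθ.2, pi_pos])

lemma integral_reducedIntegrand_zero_neg {R : ℝ} (hR : 0 < R) :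
    ∫ z in rect, reducedIntegrand R (0, 0) z < 0 := by
  have hk := dslope_momentDensity_one_pos hR
  set k := dslope (momentDensity R) 1 1 with hkdef
  have heq : ∀ z : ℝ × ℝ, k * (1 - 2 * cos z.1 ^ 2) * (cos z.2 * sin z.2) -
      reducedIntegrand R (0, 0) z =
      2 * k * cos z.2 * ((weight 0 z.1 z.2 - cos z.1 ^ 2) * sin z.2) := by
    intro z
    have hf : ∀ θ, fc 0 θ = -(π / 2) := by
      intro θ
      rw [fc_eq]; ring
    have hr : rhoExt 0 z.1 z.2 = 1 - 2 * weight 0 z.1 z.2 := by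
      rw [rhoExt, gc, hf, hf, neg_neg, sin_neg, sin_pi_div_two]
      ring
    simp only [reducedIntegrand, hr, zero_mul, add_zero, ← hkdef]
    ring
  have hint : IntegrableOn
      (fun z : ℝ × ℝ => k * (1 - 2 * cos z.1 ^ 2) * (cos z.2 * sin z.2)) rect :=
    Continuous.integrableOn_rect (by fun_prop)
  have hred := integrableOn_reducedIntegrand R (p := (0, 0)) (by simp)
  have hpos : 0 < ∫ z in rect, (k * (1 - 2 * cos z.1 ^ 2) * (cos z.2 * sin z.2) -
      reducedIntegrand R (0, 0) z) := by
    refine setIntegral_rect_pos (hint.sub hred) ?_ ?_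
    · intro z hz
      rw [heq]
      have := (cos_pos_of_mem_Ioo hz.2).le
      exact mul_nonneg (by positivity) (weight_zero_sub_mul_sin hz.2)
    · intro z hz
      rw [heq]
      have hpi := pi_pos
      have hm : z.2 ∈ Ioo (-(π / 2)) (π / 2) := ⟨by linarith [hz.2.1], hz.2.2⟩
      have h1 := cos_pos_of_mem_Ioo hm
      have h2 := sin_pos_of_pos_of_lt_pi hz.2.1 (by linarith [hz.2.2])
      have h3 := cos_pos_of_mem_Ioo (x := z.1) ⟨by linarith [hz.1.1], hz.1.2⟩
      have h4 := sin_pos_of_pos_of_lt_pi hz.1.1 (by linarith [hz.1.2])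
      have hc : (0 : ℝ) ∈ Icc (0 : ℝ) 1 := by simp
      have hw : cos z.1 ^ 2 < weight 0 z.1 z.2 :=
        cos_sq_lt_div (pow_pos h3 2) (pow_pos h4 2) (cos_sq_add_sin_sq _)
          (cosRatio_pos hc hm) (cosRatio_pos hc (neg_mem_Ioo_pi hm))
          (cosRatio_zero_neg_lt hz.2.1 hz.2.2)
      have := sub_pos.2 hw
      positivity
  rw [integral_sub hint hred,
    setIntegral_rect_mul_cos_sin (fun φ => k * (1 - 2 * cos φ ^ 2))] at hpos
  linarith

lemma firstMoment_eq (R : ℝ) {c d : ℝ} (hc : c ∈ Ioc (0 : ℝ) 1) (hd : d ∈ Icc (0 : ℝ) 1) :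
    ∫ φ in (0:ℝ)..(2*π), ∫ θ in (-(π/2))..(π/2),
      (2/3 - (3*R^2*(1 + d * rhoc c θ φ)^2 + 2) /
        (3 * (R^2*(1 + d * rhoc c θ φ)^2 + 1) ^ ((3:ℝ)/2))) * cos θ * sin θ =
      d * ∫ z in rect, reducedIntegrand R (c, d) z := by
  have hp : ((c, d) : ℝ × ℝ) ∈ Icc (0 : ℝ) 1 ×ˢ Icc (0 : ℝ) 1 := ⟨⟨hc.1.le, hc.2⟩, hd⟩
  have hi1 : IntegrableOn (fun z : ℝ × ℝ => momentDensity R 1 * (cos z.2 * sin z.2)) rect :=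
    Continuous.integrableOn_rect (by fun_prop)
  have hi2 := (integrableOn_reducedIntegrand R hp).const_mul d
  have h1 : ∫ z in rect, (momentDensity R 1 * (cos z.2 * sin z.2) +
      d * reducedIntegrand R (c, d) z) = d * ∫ z in rect, reducedIntegrand R (c, d) z := by
    rw [integral_add hi1 hi2, setIntegral_rect_mul_cos_sin (fun _ => momentDensity R 1),
      zero_add, integral_const_mul]
  rw [← h1, rect, Measure.volume_eq_prod,
    setIntegral_prod (fun z : ℝ × ℝ => momentDensity R 1 * (cos z.2 * sin z.2) +
      d * reducedIntegrand R (c, d) z) (hi1.add hi2),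
    intervalIntegral.integral_of_le (by positivity), integral_Ioc_eq_integral_Ioo]
  refine setIntegral_congr_fun measurableSet_Ioo fun φ _ => ?_
  simp only
  rw [intervalIntegral.integral_of_le (by linarith [pi_pos]), integral_Ioc_eq_integral_Ioo]
  refine setIntegral_congr_fun measurableSet_Ioo fun θ hθ => ?_
  have := momentDensity_one_add R (d * rhoExt c φ θ)
  simp only [rhoc_eq_rhoExt hc.1.ne' hθ, reducedIntegrand]
  rw [momentDensity] at this
  rw [this]
  ring

/-- Lemma 4.7 (centering lemma): for every `R > 0` there are `0 < c₁ < c₂ < 1`, `0 < d₀ < 1`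
and `F : (0, d₀) → [c₁, c₂]` such that for all `d ∈ (0, d₀)` the spherical first moment
`M₃(K(F(d), d))` vanishes, i.e. the spherical centroid of the body corresponding to
`K(F(d), d)` under the gnomonic projection is the north pole. -/
theorem stmt_14 (R : ℝ) (hR : 0 < R) :
    ∃ c₁ c₂ d₀ : ℝ, 0 < c₁ ∧ c₁ < c₂ ∧ c₂ < 1 ∧ 0 < d₀ ∧ d₀ < 1 ∧
      ∃ F : ℝ → ℝ, (∀ d ∈ Set.Ioo 0 d₀, F d ∈ Set.Icc c₁ c₂) ∧
        ∀ d ∈ Set.Ioo 0 d₀,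
          ∫ φ in (0:ℝ)..(2*π), ∫ θ in (-(π/2))..(π/2),
            (2/3 - (3*R^2*(1 + d * rhoc (F d) θ φ)^2 + 2) /
              (3 * (R^2*(1 + d * rhoc (F d) θ φ)^2 + 1) ^ ((3:ℝ)/2))) * cos θ * sin θ
            = 0 := by
  have hcont := continuousOn_integral_reducedIntegrand R
  set N : ℝ × ℝ → ℝ := fun p => ∫ z in rect, reducedIntegrand R p z
  have hneg : ∀ᶠ p in 𝓝[Icc (0 : ℝ) 1 ×ˢ Icc (0 : ℝ) 1] ((0, 0) : ℝ × ℝ), N p < 0 :=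
    (hcont (0, 0) (by simp)).eventually_lt_const (integral_reducedIntegrand_zero_neg hR)
  have hpos : ∀ᶠ p in 𝓝[Icc (0 : ℝ) 1 ×ˢ Icc (0 : ℝ) 1] ((1, 0) : ℝ × ℝ), 0 < N p :=
    (hcont (1, 0) (by simp)).eventually_const_lt (integral_reducedIntegrand_one_pos hR)
  obtain ⟨ε₁, hε₁, h₁⟩ := Metric.mem_nhdsWithin_iff.1 hneg
  obtain ⟨ε₂, hε₂, h₂⟩ := Metric.mem_nhdsWithin_iff.1 hpos
  obtain ⟨δ, hδ0, hδ⟩ := exists_between (lt_min (lt_min hε₁ hε₂) (by norm_num : (0 : ℝ) < 1 / 2))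
  simp only [lt_min_iff] at hδ
  obtain ⟨⟨hδ1, hδ2⟩, hδ3⟩ := hδ
  have hroot : ∀ d ∈ Ioo 0 δ, ∃ c ∈ Icc δ (1 - δ), N (c, d) = 0 := by
    intro d hd
    have hd1 : d ∈ Icc (0 : ℝ) 1 := ⟨hd.1.le, by linarith [hd.2]⟩
    have hsub : ContinuousOn (fun c => N (c, d)) (Icc δ (1 - δ)) :=
      hcont.comp (by fun_prop) fun c hc =>
        ⟨⟨hδ0.le.trans hc.1, by linarith [hc.2]⟩, hd1⟩
    have hl : N (δ, d) < 0 := by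
      refine h₁ ⟨?_, ⟨hδ0.le, by linarith⟩, hd1⟩
      rw [Metric.mem_ball, Prod.dist_eq, Real.dist_eq, Real.dist_eq, max_lt_iff]
      simp only [sub_zero, abs_of_pos hδ0, abs_of_pos hd.1]
      exact ⟨hδ1, hd.2.trans hδ1⟩
    have hr : 0 < N (1 - δ, d) := by
      refine h₂ ⟨?_, ⟨by linarith, by linarith⟩, hd1⟩
      rw [Metric.mem_ball, Prod.dist_eq, Real.dist_eq, Real.dist_eq, max_lt_iff]
      simp only [sub_zero, sub_sub_cancel_left, abs_neg, abs_of_pos hδ0, abs_of_pos hd.1]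
      exact ⟨hδ2, hd.2.trans hδ2⟩
    exact intermediate_value_Icc (by linarith) hsub ⟨hl.le, hr.le⟩
  choose! F hF hF0 using hroot
  refine ⟨δ, 1 - δ, δ, hδ0, by linarith, by linarith, hδ0, by linarith, F, hF, fun d hd => ?_⟩
  have hFd := hF d hd
  rw [firstMoment_eq R ⟨hδ0.trans_le hFd.1, by linarith [hFd.2]⟩
    ⟨hd.1.le, by linarith [hd.2]⟩]
  exact mul_eq_zero_of_right _ (hF0 d hd)
end
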